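/- Let Λ and Υ be nonempty countable sets, λ : Λ → Λ and μ : Υ → Υ arbitrary maps, and consider the product dynamical system σ_λ × σ_μ : X^Λ × X^Υ → X^Λ × X^Υ, (x,y) ↦ (σ_λ(x), σ_μ(y)), on the compact metrizable space X^Λ × X^Υ. Then (X^Λ × X^Υ, σ_λ × σ_μ) is uniform distributional chaotic (for any compatible metric) if and only if at least one of (X^Λ, σ_λ) and (X^Υ, σ_μ) is uniform distributional chaotic. -/

import Mathlib

open Filter Topology

/-- `d : Y → Y → ℝ` is a metric on the topological space `Y` compatible with
(i.e. inducing) its topology. -/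
def IsCompatibleMetric (Y : Type*) [t : TopologicalSpace Y] (d : Y → Y → ℝ) : Prop :=
  ∃ m : MetricSpace Y, m.toUniformSpace.toTopologicalSpace = t ∧ ∀ a b, m.dist a b = d a b

/-- The generalized shift `σ_φ : X^Γ → X^Γ`, `σ_φ((x_α)_α) = (x_{φ(α)})_α`. -/
def genShift {X Γ : Type*} (φ : Γ → Γ) (x : Γ → X) : Γ → X := fun α => x (φ α)

/-- `θ` is a quasi-periodic point of `φ` iff its forward orbit `{φ^n(θ) : n ≥ 0}` is finite. -/
def QuasiPeriodic {Γ : Type*} (φ : Γ → Γ) (θ : Γ) : Prop :=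
  (Set.range fun n : ℕ => φ^[n] θ).Finite

/-- `θ` is a periodic point of `φ` iff `φ^n(θ) = θ` for some `n ≥ 1`. -/
def PeriodicPt {Γ : Type*} (φ : Γ → Γ) (θ : Γ) : Prop := ∃ n ≥ 1, φ^[n] θ = θ

/-- `ξ(x,y,t,n) = #{i ∈ {0,…,n−1} : d(f^i(x), f^i(y)) < t}`. -/
noncomputable def xiCount {Y : Type*} (d : Y → Y → ℝ) (f : Y → Y) (x y : Y) (t : ℝ) (n : ℕ) :
    ℕ :=
  {i : ℕ | i < n ∧ d (f^[i] x) (f^[i] y) < t}.ncard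

/-- `F_{xy}(t) = liminf_n ξ(x,y,t,n)/n`. -/
noncomputable def Fdist {Y : Type*} (d : Y → Y → ℝ) (f : Y → Y) (x y : Y) (t : ℝ) : ℝ :=
  liminf (fun n : ℕ => (xiCount d f x y t n : ℝ) / n) atTop

/-- `F*_{xy}(t) = limsup_n ξ(x,y,t,n)/n`. -/
noncomputable def FdistStar {Y : Type*} (d : Y → Y → ℝ) (f : Y → Y) (x y : Y) (t : ℝ) : ℝ :=
  limsup (fun n : ℕ => (xiCount d f x y t n : ℝ) / n) atTop

/-- `ζ(x,y,γ_D,n) = #{i ∈ {0,…,n−1} : (f^i(x), f^i(y)) ∈ γ_D}` where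
`γ_D = {(u,v) : u_α = v_α for all α ∈ D}`. -/
noncomputable def zetaCount {X Γ : Type*} (f : (Γ → X) → (Γ → X)) (x y : Γ → X) (D : Set Γ)
    (n : ℕ) : ℕ :=
  {i : ℕ | i < n ∧ ∀ α ∈ D, f^[i] x α = f^[i] y α}.ncard

/-- `G_{xy}(γ_D) = liminf_n ζ(x,y,γ_D,n)/n`. -/
noncomputable def Gdist {X Γ : Type*} (f : (Γ → X) → (Γ → X)) (x y : Γ → X) (D : Set Γ) : ℝ :=
  liminf (fun n : ℕ => (zetaCount f x y D n : ℝ) / n) atTop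

/-- `G*_{xy}(γ_D) = limsup_n ζ(x,y,γ_D,n)/n`. -/
noncomputable def GdistStar {X Γ : Type*} (f : (Γ → X) → (Γ → X)) (x y : Γ → X) (D : Set Γ) :
    ℝ :=
  limsup (fun n : ℕ => (zetaCount f x y D n : ℝ) / n) atTop

/-- `x, y` are distributionally scrambled of type 1 (w.r.t. the metric `d` and the map `f`). -/
def DistScrambled1 {Y : Type*} (d : Y → Y → ℝ) (f : Y → Y) (x y : Y) : Prop :=
  (∃ s > 0, Fdist d f x y s = 0) ∧ ∀ s > 0, FdistStar d f x y s = 1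

/-- `x, y` are distributionally scrambled of type 2. -/
def DistScrambled2 {Y : Type*} (d : Y → Y → ℝ) (f : Y → Y) (x y : Y) : Prop :=
  (∃ s > 0, Fdist d f x y s < 1) ∧ ∀ s > 0, FdistStar d f x y s = 1

/-- `x, y` are distributionally scrambled of type 3. -/
def DistScrambled3 {Y : Type*} (d : Y → Y → ℝ) (f : Y → Y) (x y : Y) : Prop :=
  ∃ a b : ℝ, 0 < a ∧ a < b ∧ ∀ s ∈ Set.Icc a b, Fdist d f x y s < FdistStar d f x y s

/-- `A` is a distributionally scrambled set of type 1: it has at least two elements and all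
pairs of distinct points of `A` are distributionally scrambled of type 1. -/
def DistScrambledSet1 {Y : Type*} (d : Y → Y → ℝ) (f : Y → Y) (A : Set Y) : Prop :=
  A.Nontrivial ∧ ∀ x ∈ A, ∀ y ∈ A, x ≠ y → DistScrambled1 d f x y

/-- `A` is a distributionally scrambled set of type 2. -/
def DistScrambledSet2 {Y : Type*} (d : Y → Y → ℝ) (f : Y → Y) (A : Set Y) : Prop :=
  A.Nontrivial ∧ ∀ x ∈ A, ∀ y ∈ A, x ≠ y → DistScrambled2 d f x y

/-- `A` is a distributionally scrambled set of type 3. -/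
def DistScrambledSet3 {Y : Type*} (d : Y → Y → ℝ) (f : Y → Y) (A : Set Y) : Prop :=
  A.Nontrivial ∧ ∀ x ∈ A, ∀ y ∈ A, x ≠ y → DistScrambled3 d f x y

/-- `(Y,f)` is uniform distributionally chaotic: there is an uncountable distributionally
scrambled set `A` of type 1 and a single `ε > 0` with `F_{xy}(ε) = 0` for distinct `x,y ∈ A`. -/
def UniformDC {Y : Type*} (d : Y → Y → ℝ) (f : Y → Y) : Prop :=
  ∃ A : Set Y, ¬ A.Countable ∧ DistScrambledSet1 d f A ∧
    ∃ ε > 0, ∀ x ∈ A, ∀ y ∈ A, x ≠ y → Fdist d f x y ε = 0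

/-- `a` is a transitive point of `f`: its forward orbit is dense. -/
def TransitivePoint {Y : Type*} [TopologicalSpace Y] (f : Y → Y) (a : Y) : Prop :=
  Dense (Set.range fun n : ℕ => f^[n] a)

/-- `(Y,f)` is dense distributionally chaotic: uniform distributional chaos witnessed by a
dense set. -/
def DenseDC {Y : Type*} [TopologicalSpace Y] (d : Y → Y → ℝ) (f : Y → Y) : Prop :=
  ∃ A : Set Y, ¬ A.Countable ∧ Dense A ∧ DistScrambledSet1 d f A ∧
    ∃ ε > 0, ∀ x ∈ A, ∀ y ∈ A, x ≠ y → Fdist d f x y ε = 0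

/-- `(Y,f)` is transitive distributionally chaotic: uniform distributional chaos witnessed by a
dense set of transitive points. -/
def TransitiveDC {Y : Type*} [TopologicalSpace Y] (d : Y → Y → ℝ) (f : Y → Y) : Prop :=
  ∃ A : Set Y, ¬ A.Countable ∧ Dense A ∧ (∀ a ∈ A, TransitivePoint f a) ∧
    DistScrambledSet1 d f A ∧
    ∃ ε > 0, ∀ x ∈ A, ∀ y ∈ A, x ≠ y → Fdist d f x y ε = 0

/-- The ω-limit set of `a` under `f`: all limits of `f^[n k] a` along strictly increasing
sequences `n`. -/
def OmegaSet {Y : Type*} [TopologicalSpace Y] (f : Y → Y) (a : Y) : Set Y :=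
  {z | ∃ n : ℕ → ℕ, StrictMono n ∧ Tendsto (fun k => f^[n k] a) atTop (nhds z)}

/-- The set of periodic points of `f`. -/
def PerSet {Y : Type*} (f : Y → Y) : Set Y := {y | ∃ n ≥ 1, f^[n] y = y}

/-- `x, y` are `ω^u`-scrambled. -/
def OmegaUScrambled {Y : Type*} [TopologicalSpace Y] (f : Y → Y) (x y : Y) : Prop :=
  ¬ (OmegaSet f x \ OmegaSet f y).Countable ∧
    (OmegaSet f x ∩ OmegaSet f y).Nonempty ∧ (OmegaSet f x \ PerSet f).Nonempty

/-- `x, y` are `ω^∞`-scrambled. -/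
def OmegaInfScrambled {Y : Type*} [TopologicalSpace Y] (f : Y → Y) (x y : Y) : Prop :=
  (OmegaSet f x \ OmegaSet f y).Infinite ∧
    (OmegaSet f x ∩ OmegaSet f y).Nonempty ∧ (OmegaSet f x \ PerSet f).Nonempty

/-- `A` is an `ω^u`-scrambled set. -/
def OmegaUScrambledSet {Y : Type*} [TopologicalSpace Y] (f : Y → Y) (A : Set Y) : Prop :=
  A.Nontrivial ∧ ∀ x ∈ A, ∀ y ∈ A, x ≠ y → OmegaUScrambled f x y

/-- `A` is an `ω^∞`-scrambled set. -/
def OmegaInfScrambledSet {Y : Type*} [TopologicalSpace Y] (f : Y → Y) (A : Set Y) : Prop :=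
  A.Nontrivial ∧ ∀ x ∈ A, ∀ y ∈ A, x ≠ y → OmegaInfScrambled f x y

variable {X : Type*} [Fintype X] [TopologicalSpace X] [DiscreteTopology X] [Nontrivial X]
variable {Γ : Type*} [Countable Γ] [Nonempty Γ]

/-! ### Densities of sets of times -/

theorem ncard_lt_and_le (P : ℕ → Prop) (n : ℕ) : {i : ℕ | i < n ∧ P i}.ncard ≤ n := by
  have h := Set.ncard_le_ncard (s := {i : ℕ | i < n ∧ P i}) (t := (Finset.range n : Set ℕ))
    (fun i hi => by simpa using hi.1) (Finset.finite_toSet _)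
  simpa using h

theorem le_ncard_lt_and {P : ℕ → Prop} {a b n : ℕ} (hb : b ≤ n)
    (h : ∀ i, a ≤ i → i < b → P i) : b - a ≤ {i : ℕ | i < n ∧ P i}.ncard := by
  have h := Set.ncard_le_ncard (s := (Finset.Ico a b : Set ℕ)) (t := {i : ℕ | i < n ∧ P i})
    (fun i hi => by
      have hi : a ≤ i ∧ i < b := by simpa using hi
      exact ⟨by omega, h i hi.1 hi.2⟩)
    ((Set.finite_lt_nat n).subset fun i hi => hi.1)
  rwa [Set.ncard_coe_finset, Nat.card_Ico] at h

theorem density_nonneg (P : ℕ → Prop) (n : ℕ) :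
    (0 : ℝ) ≤ ({i : ℕ | i < n ∧ P i}.ncard : ℝ) / n := by positivity

theorem density_le_one (P : ℕ → Prop) (n : ℕ) :
    ({i : ℕ | i < n ∧ P i}.ncard : ℝ) / n ≤ 1 :=
  div_le_one_of_le₀ (by exact_mod_cast ncard_lt_and_le P n) (by positivity)

theorem isBoundedUnder_le_density (P : ℕ → Prop) :
    atTop.IsBoundedUnder (· ≤ ·) fun n : ℕ => ({i : ℕ | i < n ∧ P i}.ncard : ℝ) / n :=
  isBoundedUnder_of ⟨1, density_le_one P⟩

theorem isBoundedUnder_ge_density (P : ℕ → Prop) :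
    atTop.IsBoundedUnder (· ≥ ·) fun n : ℕ => ({i : ℕ | i < n ∧ P i}.ncard : ℝ) / n :=
  isBoundedUnder_of ⟨0, density_nonneg P⟩

/-- A set of times missing the windows `[N, N ^ 2)` for arbitrarily large `N` has lower
density zero. -/
theorem liminf_density_eq_zero {P : ℕ → Prop}
    (h : ∀ K, ∃ N ≥ K, ∀ i, N ≤ i → i < N ^ 2 → ¬ P i) :
    liminf (fun n : ℕ => ({i : ℕ | i < n ∧ P i}.ncard : ℝ) / n) atTop = 0 := by
  refine le_antisymm (le_of_forall_pos_le_add fun η hη => ?_)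
    (le_liminf_of_le (isBoundedUnder_le_density P).isCoboundedUnder_ge
      (Eventually.of_forall (density_nonneg P)))
  rw [zero_add]
  refine liminf_le_of_frequently_le (frequently_atTop.2 fun M => ?_)
    (isBoundedUnder_ge_density P)
  obtain ⟨k, hk⟩ := exists_nat_gt (1 / η)
  obtain ⟨N, hN, hP⟩ := h (M + k + 1)
  have hNpos : (0 : ℝ) < N := by exact_mod_cast (show 0 < N by omega)
  have hcard : {i : ℕ | i < N ^ 2 ∧ P i}.ncard ≤ N := by
    have := Set.ncard_le_ncard (s := {i : ℕ | i < N ^ 2 ∧ P i}) (t := (Finset.range N : Set ℕ))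
      (fun i hi => by
        by_contra hlt
        exact hP i (by simpa using hlt) hi.1 hi.2) (Finset.finite_toSet _)
    simpa using this
  refine ⟨N ^ 2, by nlinarith, ?_⟩
  have hkN : (k : ℝ) ≤ N := by exact_mod_cast (show k ≤ N by omega)
  have hcard' : ({i : ℕ | i < N ^ 2 ∧ P i}.ncard : ℝ) ≤ N := by exact_mod_cast hcard
  have h1 : 1 < N * η := by
    rw [div_lt_iff₀ hη] at hk
    nlinarith
  push_cast
  rw [div_le_iff₀ (by positivity)]
  nlinarith

/-- A set of times containing the windows `[N + C, N ^ 2 - C)` for arbitrarily large `N` has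
upper density one. -/
theorem limsup_density_eq_one {P : ℕ → Prop} (C : ℕ)
    (h : ∀ K, ∃ N ≥ K, ∀ i, N + C ≤ i → i + C < N ^ 2 → P i) :
    limsup (fun n : ℕ => ({i : ℕ | i < n ∧ P i}.ncard : ℝ) / n) atTop = 1 := by
  refine le_antisymm (limsup_le_of_le (isBoundedUnder_ge_density P).isCoboundedUnder_le
      (Eventually.of_forall (density_le_one P))) (le_of_forall_pos_le_add fun η hη => ?_)
  rw [← sub_le_iff_le_add]
  refine le_limsup_of_frequently_le (frequently_atTop.2 fun M => ?_)
    (isBoundedUnder_le_density P)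
  obtain ⟨k, hk⟩ := exists_nat_gt ((1 + 2 * C) / η)
  obtain ⟨N, hN, hP⟩ := h (M + k + 1)
  have hNpos : (1 : ℝ) ≤ N := by exact_mod_cast (show 1 ≤ N by omega)
  have hcard := le_ncard_lt_and (P := P) (a := N + C) (b := N ^ 2 - C) (n := N ^ 2)
    (Nat.sub_le _ _) fun i h1 h2 => hP i h1 (by omega)
  have hcard' : N ^ 2 ≤ {i : ℕ | i < N ^ 2 ∧ P i}.ncard + (N + 2 * C) := by omega
  refine ⟨N ^ 2, by nlinarith, ?_⟩
  have hkN : (k : ℝ) ≤ N := by exact_mod_cast (show k ≤ N by omega)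
  have hcard'' : (N : ℝ) ^ 2 ≤ ({i : ℕ | i < N ^ 2 ∧ P i}.ncard : ℝ) + (N + 2 * C) := by
    exact_mod_cast hcard'
  have h1 : 1 + 2 * C < N * η := by
    rw [div_lt_iff₀ hη] at hk
    nlinarith
  have hC : (0 : ℝ) ≤ C := by positivity
  push_cast
  rw [le_div_iff₀ (by positivity)]
  nlinarith

theorem liminf_density_ne_zero {P : ℕ → Prop} {N : ℕ} (h : ∀ i ≥ N, P i) :
    liminf (fun n : ℕ => ({i : ℕ | i < n ∧ P i}.ncard : ℝ) / n) atTop ≠ 0 := by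
  refine ne_of_gt (lt_of_lt_of_le (show (0 : ℝ) < 1 / 2 by norm_num)
    (le_liminf_of_le (isBoundedUnder_le_density P).isCoboundedUnder_ge ?_))
  filter_upwards [eventually_ge_atTop (2 * N + 1)] with n hn
  have hcard := le_ncard_lt_and (P := P) (a := N) (b := n) (n := n) le_rfl fun i h1 _ => h i h1
  have hcard' : (n : ℝ) ≤ 2 * {i : ℕ | i < n ∧ P i}.ncard := by
    exact_mod_cast (show n ≤ 2 * {i : ℕ | i < n ∧ P i}.ncard by omega)
  have hn' : (0 : ℝ) < n := by exact_mod_cast (show 0 < n by omega)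
  rw [le_div_iff₀ hn']
  linarith

theorem exists_of_limsup_density_eq_one {P : ℕ → Prop}
    (h : limsup (fun n : ℕ => ({i : ℕ | i < n ∧ P i}.ncard : ℝ) / n) atTop = 1) :
    ∃ i, P i := by
  by_contra! hP
  simp [hP] at h

/-! ### Compatible metrics -/

section Metric

variable {S ι : Type*} [TopologicalSpace S] [DiscreteTopology S] [Finite S]

theorem IsCompatibleMetric.hasBasis {d : (ι → S) → (ι → S) → ℝ}
    (hd : IsCompatibleMetric (ι → S) d) :
    ∃ F : Filter ((ι → S) × (ι → S)),
      F.HasBasis (fun ε : ℝ => 0 < ε) (fun ε => {p | d p.1 p.2 < ε}) ∧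
      F.HasBasis (fun D : Set ι => D.Finite) (fun D => {p | ∀ α ∈ D, p.1 α = p.2 α}) := by
  obtain ⟨m, hm, hmd⟩ := hd
  let _ : UniformSpace S := ⊥
  have htop : (inferInstance : UniformSpace S).toTopologicalSpace = ‹TopologicalSpace S› :=
    (DiscreteTopology.eq_bot (α := S)).symm
  have hpi : (Pi.uniformSpace fun _ : ι => S).toTopologicalSpace =
      (@Pi.topologicalSpace ι (fun _ => S) fun _ => ‹TopologicalSpace S›) := by
    rw [← htop]
    rfl
  have hu : m.toUniformSpace = Pi.uniformSpace fun _ : ι => S :=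
    unique_uniformity_of_compact hm hpi
  refine ⟨@uniformity _ m.toUniformSpace, ?_, ?_⟩
  · have := @Metric.uniformity_basis_dist _ m.toPseudoMetricSpace
    simp only [← hmd]
    exact this
  · rw [hu, Pi.uniformity]
    have := hasBasis_iInf_principal_finite
      (fun i : ι => {p : (ι → S) × (ι → S) | p.1 i = p.2 i})
    have hbot : uniformity S = 𝓟 SetRel.id := rfl
    simp only [hbot, comap_principal]
    convert! this using 1
    ext D p
    simp

/-- Agreement on a suitable finite set of coordinates forces closeness. -/
theorem IsCompatibleMetric.exists_finite_lt {d : (ι → S) → (ι → S) → ℝ}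
    (hd : IsCompatibleMetric (ι → S) d) {ε : ℝ} (hε : 0 < ε) :
    ∃ D : Set ι, D.Finite ∧ ∀ x y : ι → S, (∀ α ∈ D, x α = y α) → d x y < ε := by
  obtain ⟨F, h1, h2⟩ := hd.hasBasis
  obtain ⟨D, hD, hsub⟩ := h2.mem_iff.1 (h1.mem_of_mem hε)
  exact ⟨D, hD, fun x y h => @hsub (x, y) h⟩

/-- Close points agree on a prescribed finite set of coordinates. -/
theorem IsCompatibleMetric.exists_pos_agree {d : (ι → S) → (ι → S) → ℝ}
    (hd : IsCompatibleMetric (ι → S) d) {D : Set ι} (hD : D.Finite) :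
    ∃ ε > 0, ∀ x y : ι → S, d x y < ε → ∀ α ∈ D, x α = y α := by
  obtain ⟨F, h1, h2⟩ := hd.hasBasis
  obtain ⟨ε, hε, hsub⟩ := h1.mem_iff.1 (h2.mem_of_mem hD)
  exact ⟨ε, hε, fun x y h => @hsub (x, y) h⟩

end Metric

theorem IsCompatibleMetric.comp_homeomorph {Y Z : Type*} [tY : TopologicalSpace Y]
    [tZ : TopologicalSpace Z] {d : Y → Y → ℝ} (hd : IsCompatibleMetric Y d) (e : Z ≃ₜ Y) :
    IsCompatibleMetric Z fun a b => d (e a) (e b) := by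
  obtain ⟨m, hm, hmd⟩ := hd
  refine ⟨MetricSpace.induced e e.injective m, ?_, fun a b => hmd _ _⟩
  have : TopologicalSpace.induced e m.toUniformSpace.toTopologicalSpace = tZ := by
    rw [hm]
    exact e.induced_eq
  exact this

/-! ### Conjugacy invariance -/

theorem UniformDC.of_semiconj {Y Z : Type*} {d : Y → Y → ℝ} {f : Y → Y} {g : Z → Z}
    (e : Z ≃ Y) (h : Function.Semiconj e g f) (hg : UniformDC (fun a b => d (e a) (e b)) g) :
    UniformDC d f := by
  have hxi : ∀ a b t n,
      xiCount (fun a b => d (e a) (e b)) g a b t n = xiCount d f (e a) (e b) t n := by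
    intro a b t n
    simp only [xiCount, (h.iterate_right _).eq]
  have hF : ∀ a b t, Fdist (fun a b => d (e a) (e b)) g a b t = Fdist d f (e a) (e b) t := by
    simp only [Fdist, hxi, implies_true]
  have hFs : ∀ a b t,
      FdistStar (fun a b => d (e a) (e b)) g a b t = FdistStar d f (e a) (e b) t := by
    simp only [FdistStar, hxi, implies_true]
  obtain ⟨A, hA, ⟨hnt, hscr⟩, ε, hε, hAε⟩ := hg
  refine ⟨e '' A, fun hc => hA (Set.countable_of_injective_of_countable_image e.injective.injOn hc),
    ⟨hnt.image e.injective, ?_⟩, ε, hε, ?_⟩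
  · rintro _ ⟨x, hx, rfl⟩ _ ⟨y, hy, rfl⟩ hxy
    have := hscr x hx y hy (fun h => hxy (h ▸ rfl))
    simpa only [DistScrambled1, hF, hFs] using this
  · rintro _ ⟨x, hx, rfl⟩ _ ⟨y, hy, rfl⟩ hxy
    have := hAε x hx y hy (fun h => hxy (h ▸ rfl))
    simpa only [hF] using this

theorem uniformDC_iff_of_semiconj {Y Z : Type*} {d : Y → Y → ℝ} {f : Y → Y} {g : Z → Z}
    (e : Z ≃ Y) (h : Function.Semiconj e g f) :
    UniformDC (fun a b => d (e a) (e b)) g ↔ UniformDC d f := by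
  refine ⟨UniformDC.of_semiconj e h, fun hf => UniformDC.of_semiconj (g := f) e.symm ?_ ?_⟩
  · intro y
    rw [e.symm_apply_eq, h.eq, e.apply_symm_apply]
  · simpa using hf

/-! ### Generalized shifts -/

theorem genShift_iterate {S ι : Type*} (φ : ι → ι) (n : ℕ) (x : ι → S) (α : ι) :
    (genShift φ)^[n] x α = x (φ^[n] α) := by
  induction n generalizing x with
  | zero => rfl
  | succ n ih =>
    rw [Function.iterate_succ_apply, ih, genShift, Function.iterate_succ_apply']

theorem injective_iterate_of_not_quasiPeriodic {ι : Type*} {φ : ι → ι} {θ : ι}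
    (h : ¬ QuasiPeriodic φ θ) : Function.Injective fun n : ℕ => φ^[n] θ := by
  have key : ∀ m k : ℕ, φ^[m] θ ≠ φ^[m + k + 1] θ := by
    intro m k hmk
    refine h (((Finset.range (m + k + 1)).finite_toSet.image fun n => φ^[n] θ).subset ?_)
    rintro _ ⟨n, rfl⟩
    induction n using Nat.strong_induction_on with
    | _ n ih =>
      rcases lt_or_ge n (m + k + 1) with hn | hn
      · exact ⟨n, by simpa using hn, rfl⟩
      · obtain ⟨j, rfl⟩ := Nat.exists_eq_add_of_le' hn
        have : φ^[j + (m + k + 1)] θ = φ^[j + m] θ := by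
          rw [Function.iterate_add_apply, ← hmk, ← Function.iterate_add_apply]
        simpa only [this] using ih (j + m) (by omega)
  intro a b hab
  rcases lt_trichotomy a b with hlt | heq | hlt
  · obtain ⟨k, rfl⟩ := Nat.exists_eq_add_of_lt hlt
    exact absurd hab (key a k)
  · exact heq
  · obtain ⟨k, rfl⟩ := Nat.exists_eq_add_of_lt hlt
    exact absurd hab.symm (key b k)

/-- There is a partition of the times into colours `0, 1, 2, …` such that every colour fills
windows `[N, N ^ 2)` with `N` arbitrarily large. -/
theorem exists_window_coloring :
    ∃ c : ℕ → ℕ, ∀ m K, ∃ N ≥ K, 2 ≤ N ∧ ∀ i, N ≤ i → i < N ^ 2 → c i = m := by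
  refine ⟨fun i => (Nat.unpair (Nat.log 2 (Nat.log 2 i))).1, fun m K => ?_⟩
  set k := Nat.pair m K with hk
  have hKk : K ≤ k := Nat.right_le_pair m K
  have h1 : k < 2 ^ k := Nat.lt_two_pow_self
  have h2 : 2 ^ k < 2 ^ 2 ^ k := Nat.lt_two_pow_self
  refine ⟨2 ^ 2 ^ k, by omega, by omega, fun i hi hi' => ?_⟩
  have hi0 : i ≠ 0 := by omega
  rw [← pow_mul, ← pow_succ] at hi'
  have h3 : 2 ^ k ≤ Nat.log 2 i := (Nat.le_log_iff_pow_le one_lt_two hi0).2 hi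
  have h4 : Nat.log 2 i < 2 ^ (k + 1) := (Nat.log_lt_iff_lt_pow one_lt_two hi0).2 hi'
  have h5 : Nat.log 2 (Nat.log 2 i) = k :=
    (Nat.log_eq_iff (Or.inr ⟨one_lt_two, by omega⟩)).2 ⟨h3, h4⟩
  simp [h5, hk]

section Characterization

variable {S ι : Type*} [TopologicalSpace S] [DiscreteTopology S] [Finite S]

theorem exists_not_quasiPeriodic_of_uniformDC {φ : ι → ι} {d : (ι → S) → (ι → S) → ℝ}
    (hd : IsCompatibleMetric (ι → S) d) (h : UniformDC d (genShift φ)) :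
    ∃ θ, ¬ QuasiPeriodic φ θ := by
  by_contra! hqp
  obtain ⟨A, -, ⟨⟨x, hx, y, hy, hxy⟩, hscr⟩, -⟩ := h
  obtain ⟨⟨ε, hε, hF⟩, hFs⟩ := hscr x hx y hy hxy
  obtain ⟨D, hD, hDε⟩ := hd.exists_finite_lt hε
  obtain ⟨s, hs, hagree⟩ := hd.exists_pos_agree (hD.biUnion fun α _ => hqp α)
  obtain ⟨i, hi⟩ := exists_of_limsup_density_eq_one (hFs s hs)
  refine liminf_density_ne_zero (N := i) (fun j hj => hDε _ _ fun α hα => ?_) hF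
  obtain ⟨k, rfl⟩ := Nat.exists_eq_add_of_le hj
  have := hagree _ _ hi (φ^[k] α) (Set.mem_biUnion hα ⟨k, rfl⟩)
  simpa only [genShift_iterate, ← Function.iterate_add_apply] using this

theorem uniformDC_of_not_quasiPeriodic [Nontrivial S] {φ : ι → ι}
    {d : (ι → S) → (ι → S) → ℝ} (hd : IsCompatibleMetric (ι → S) d) {θ : ι}
    (hθ : ¬ QuasiPeriodic φ θ) : UniformDC d (genShift φ) := by
  classical
  obtain ⟨a, b, hab⟩ := exists_pair_ne S
  obtain ⟨c, hc⟩ := exists_window_coloring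
  have hinj := injective_iterate_of_not_quasiPeriodic hθ
  -- `b` is written on the windows of colour `m + 1` with `m ∈ B`, and `a` everywhere else.
  let pt : Set ℕ → ι → S := fun B α =>
    if ∃ n, φ^[n] θ = α ∧ ∃ m ∈ B, c n = m + 1 then b else a
  have pt_orbit : ∀ B n, pt B (φ^[n] θ) = if ∃ m ∈ B, c n = m + 1 then b else a := by
    intro B n
    refine if_congr ⟨?_, fun h => ⟨n, rfl, h⟩⟩ rfl rfl
    rintro ⟨k, hk, h⟩
    rwa [← hinj hk]
  have pt_window : ∀ B n m, c n = m + 1 → pt B (φ^[n] θ) = if m ∈ B then b else a := by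
    intro B n m hm
    simp [pt_orbit, hm]
  have hne : ∀ B B' : Set ℕ, B ≠ B' → ∃ m, ∀ n, c n = m + 1 →
      pt B (φ^[n] θ) ≠ pt B' (φ^[n] θ) := by
    intro B B' hB
    obtain ⟨m, hm⟩ : ∃ m, ¬ (m ∈ B ↔ m ∈ B') := by
      by_contra! h
      exact hB (Set.ext h)
    refine ⟨m, fun n hn => ?_⟩
    rw [pt_window B n m hn, pt_window B' n m hn]
    by_cases h1 : m ∈ B <;> by_cases h2 : m ∈ B' <;> simp_all [hab.symm]
  have pt_inj : Function.Injective pt := by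
    intro B B' h
    by_contra hB
    obtain ⟨m, hm⟩ := hne B B' hB
    obtain ⟨N, -, hN2, hN⟩ := hc (m + 1) 0
    exact hm N (hN N le_rfl (by nlinarith)) (h ▸ rfl)
  obtain ⟨ε, hε, hagree⟩ := hd.exists_pos_agree (Set.finite_singleton θ)
  have hF : ∀ B B', B ≠ B' → Fdist d (genShift φ) (pt B) (pt B') ε = 0 := by
    intro B B' hB
    obtain ⟨m, hm⟩ := hne B B' hB
    refine liminf_density_eq_zero fun K => ?_
    obtain ⟨N, hNK, -, hN⟩ := hc (m + 1) K
    refine ⟨N, hNK, fun i h1 h2 hlt => hm i (hN i h1 h2) ?_⟩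
    simpa only [genShift_iterate] using hagree _ _ hlt θ rfl
  have hshift : ∀ δ : ι, ∃ C : ℕ, ∀ B N i, (∀ j, N ≤ j → j < N ^ 2 → c j = 0) →
      N + C ≤ i → i + C < N ^ 2 → pt B (φ^[i] δ) = a := by
    intro δ
    by_cases hδ : ∃ m n, φ^[m] δ = φ^[n] θ
    · obtain ⟨m, n, hmn⟩ := hδ
      refine ⟨m + n, fun B N i hN h1 h2 => ?_⟩
      obtain ⟨j, rfl⟩ := Nat.exists_eq_add_of_le' (show m ≤ i by omega)
      rw [Function.iterate_add_apply, hmn, ← Function.iterate_add_apply, pt_orbit,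
        hN (j + n) (by omega) (by omega)]
      simp
    · push Not at hδ
      exact ⟨0, fun B N i _ _ _ => if_neg fun ⟨n, hn, _⟩ => hδ i n hn.symm⟩
  choose C hC using hshift
  have hFs : ∀ B B', ∀ s > 0, FdistStar d (genShift φ) (pt B) (pt B') s = 1 := by
    intro B B' s hs
    obtain ⟨D, hD, hDs⟩ := hd.exists_finite_lt hs
    refine limsup_density_eq_one (hD.toFinset.sup C) fun K => ?_
    obtain ⟨N, hNK, -, hN⟩ := hc 0 K
    refine ⟨N, hNK, fun i h1 h2 => hDs _ _ fun δ hδ => ?_⟩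
    have hle : C δ ≤ hD.toFinset.sup C := Finset.le_sup (hD.mem_toFinset.2 hδ)
    rw [genShift_iterate, genShift_iterate, hC δ B N i hN (by omega) (by omega),
      hC δ B' N i hN (by omega) (by omega)]
  refine ⟨Set.range pt, ?_, ⟨?_, ?_⟩, ε, hε, ?_⟩
  · intro hcount
    have : Countable (Set ℕ) := Set.countable_univ_iff.1 <|
      Set.countable_of_injective_of_countable_image pt_inj.injOn (by rwa [Set.image_univ])
    obtain ⟨g, hg⟩ := exists_injective_nat (Set ℕ)
    exact Function.cantor_injective g hg
  · exact ⟨_, ⟨∅, rfl⟩, _, ⟨Set.univ, rfl⟩, fun h => Set.empty_ne_univ (pt_inj h)⟩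
  · rintro _ ⟨B, rfl⟩ _ ⟨B', rfl⟩ h
    exact ⟨⟨ε, hε, hF B B' fun hB => h (hB ▸ rfl)⟩, hFs B B'⟩
  · rintro _ ⟨B, rfl⟩ _ ⟨B', rfl⟩ h
    exact hF B B' fun hB => h (hB ▸ rfl)

/-- A generalized shift is uniformly distributionally chaotic iff its index map has a point
with infinite forward orbit. -/
theorem uniformDC_genShift_iff [Nontrivial S] {φ : ι → ι} {d : (ι → S) → (ι → S) → ℝ}
    (hd : IsCompatibleMetric (ι → S) d) :
    UniformDC d (genShift φ) ↔ ∃ θ, ¬ QuasiPeriodic φ θ :=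
  ⟨exists_not_quasiPeriodic_of_uniformDC hd, fun ⟨_, h⟩ => uniformDC_of_not_quasiPeriodic hd h⟩

end Characterization

theorem quasiPeriodic_iff_of_semiconj {ι κ : Type*} {φ : ι → ι} {ψ : κ → κ} {g : ι → κ}
    (hg : Function.Injective g) (h : Function.Semiconj g φ ψ) (θ : ι) :
    QuasiPeriodic ψ (g θ) ↔ QuasiPeriodic φ θ := by
  have : (Set.range fun n : ℕ => ψ^[n] (g θ)) = g '' Set.range fun n : ℕ => φ^[n] θ := by
    rw [← Set.range_comp]
    exact congrArg Set.range (funext fun n => ((h.iterate_right n).eq θ).symm)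
  rw [QuasiPeriodic, this, Set.finite_image_iff hg.injOn, QuasiPeriodic]

/-- for nonempty countable `Λ, Υ` and maps `λ, μ`, the product system
`(X^Λ × X^Υ, σ_λ × σ_μ)` is uniform distributionally chaotic (for any compatible metric)
iff at least one of `(X^Λ, σ_λ)`, `(X^Υ, σ_μ)` is uniform distributionally chaotic. -/
theorem prod_uniformDC_iff
    {Λ Υ : Type*} [Countable Λ] [Nonempty Λ] [Countable Υ] [Nonempty Υ]
    (lam : Λ → Λ) (mu : Υ → Υ)
    (dP : ((Λ → X) × (Υ → X)) → ((Λ → X) × (Υ → X)) → ℝ)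
    (hdP : IsCompatibleMetric ((Λ → X) × (Υ → X)) dP)
    (d₁ : (Λ → X) → (Λ → X) → ℝ) (hd₁ : IsCompatibleMetric (Λ → X) d₁)
    (d₂ : (Υ → X) → (Υ → X) → ℝ) (hd₂ : IsCompatibleMetric (Υ → X) d₂) :
    UniformDC dP (Prod.map (genShift (X := X) lam) (genShift (X := X) mu)) ↔
      (UniformDC d₁ (genShift (X := X) lam) ∨ UniformDC d₂ (genShift (X := X) mu)) := by
  let e : (Λ ⊕ Υ → X) ≃ₜ (Λ → X) × (Υ → X) := Homeomorph.sumArrowHomeomorphProdArrow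
  have hsemi : Function.Semiconj e (genShift (Sum.map lam mu))
      (Prod.map (genShift (X := X) lam) (genShift (X := X) mu)) := fun _ => rfl
  rw [← uniformDC_iff_of_semiconj e.toEquiv hsemi, uniformDC_genShift_iff hd₁,
    uniformDC_genShift_iff hd₂]
  refine (uniformDC_genShift_iff (hdP.comp_homeomorph e)).trans ?_
  rw [Sum.exists]
  have hl : Function.Semiconj (Sum.inl : Λ → Λ ⊕ Υ) lam (Sum.map lam mu) := fun _ => rfl
  have hr : Function.Semiconj (Sum.inr : Υ → Λ ⊕ Υ) mu (Sum.map lam mu) := fun _ => rfl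
  simp only [quasiPeriodic_iff_of_semiconj Sum.inl_injective hl,
    quasiPeriodic_iff_of_semiconj Sum.inr_injective hr]
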